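/- arXiv:2106.09597 — 3 statements merged into one kernel-verified Lean document; each statement's English description precedes it below -/
import Mathlib

section
/- Let μ₀ be a Borel probability measure (the prior) on ℝⁿ, let Γ ∈ ℝ^{N×N} be symmetric positive definite, let μ_e = N(0, Γ) be the Gaussian noise distribution on ℝᴺ, and let G : ℝⁿ → ℝᴺ be a measurable forward map. Define the least-squares potential Φ(x; Y) = ½‖Γ^{-1/2}(Y − G(x))‖². Assume Φ is measurable with respect to the product measure ν₀(dx, dY) = μ₀(dx) μ_e(dY), and that the normalization constant Z(Y) = ∫_{ℝⁿ} exp(−Φ(x; Y)) μ₀(dx) is strictly positive for μ_e-almost every Y. Then, for μ_e-almost every Y, the conditional distribution μ^Y of x given Y under the joint law of (x, Y) with Y = G(x) + e, x ~ μ₀ and e ~ μ_e independent, exists, is absolutely continuous with respect to μ₀, and its Radon–Nikodym derivative is dμ^Y/dμ₀ (x) = exp(−Φ(x; Y)) / Z(Y). -/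
open MeasureTheory ProbabilityTheory Matrix

open scoped ENNReal

section AdditiveNoise

variable {Ω S H : Type*} [MeasurableSpace Ω] [MeasurableSpace S]
  [MeasurableSpace H] [AddCommGroup H] [MeasurableAdd₂ H] [MeasurableSub₂ H]

/-- The joint law of `(G X + E, X)`, for independent `X` and `E` where `E` has density `ρ` with
respect to the invariant measure `ν`, has density `ρ (y - G x)` with respect to `ν ⊗ μ`. -/
lemma lintegral_map_add_prodMk {P : Measure Ω} [IsFiniteMeasure P]
    {μ : Measure S} [SFinite μ] {ν : Measure H} [SFinite ν] [ν.IsAddRightInvariant]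
    {ρ : H → ℝ≥0∞} (hρ : Measurable ρ) {G : S → H} (hG : Measurable G)
    {X : Ω → S} {E : Ω → H} (hX : Measurable X) (hE : Measurable E)
    (hXlaw : P.map X = μ) (hElaw : P.map E = ν.withDensity ρ) (hXE : IndepFun X E P)
    {h : H × S → ℝ≥0∞} (hh : Measurable h) :
    ∫⁻ p, h p ∂(P.map fun ω => (G (X ω) + E ω, X ω)) =
      ∫⁻ y, ∫⁻ x, ρ (y - G x) * h (y, x) ∂μ ∂ν := by
  have hjoint := hXE.map_prod_eq_prod_map_map hX.aemeasurable hE.aemeasurable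
  rw [hXlaw, hElaw] at hjoint
  calc ∫⁻ p, h p ∂(P.map fun ω => (G (X ω) + E ω, X ω))
      = ∫⁻ ω, h (G (X ω) + E ω, X ω) ∂P := lintegral_map hh (by fun_prop)
    _ = ∫⁻ q, h (G q.1 + q.2, q.1) ∂(P.map fun ω => (X ω, E ω)) :=
        (lintegral_map (g := fun ω => (X ω, E ω)) (f := fun q : S × H => h (G q.1 + q.2, q.1))
          (by fun_prop) (by fun_prop)).symm
    _ = ∫⁻ x, ∫⁻ e, h (G x + e, x) ∂(ν.withDensity ρ) ∂μ := by
        rw [hjoint, lintegral_prod _ (by fun_prop)]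
    _ = ∫⁻ x, ∫⁻ y, ρ (y - G x) * h (y, x) ∂ν ∂μ := by
        refine lintegral_congr fun x => ?_
        rw [lintegral_withDensity_eq_lintegral_mul _ hρ (by fun_prop),
          ← lintegral_sub_right_eq_self _ (G x)]
        simp
    _ = ∫⁻ y, ∫⁻ x, ρ (y - G x) * h (y, x) ∂μ ∂ν :=
        lintegral_lintegral_swap (by fun_prop)

/-- **Bayes' formula for additive noise.** If the noise has a bounded density `ρ` and the evidence
`∫ ρ (y - G x) dμ(x)` never vanishes, the posterior of `X` given `G X + E = y` has density
`ρ (y - G x)` divided by the evidence with respect to the prior `μ`. -/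
lemma condDistrib_add_noise_ae_eq [StandardBorelSpace S] [Nonempty S]
    {P : Measure Ω} [IsFiniteMeasure P]
    {μ : Measure S} [IsFiniteMeasure μ] {ν : Measure H} [SFinite ν] [ν.IsAddRightInvariant]
    {ρ : H → ℝ≥0∞} (hρ : Measurable ρ) {c : ℝ≥0∞} (hc : c ≠ ∞) (hρc : ∀ y, ρ y ≤ c)
    {G : S → H} (hG : Measurable G)
    {X : Ω → S} {E : Ω → H} (hX : Measurable X) (hE : Measurable E)
    (hXlaw : P.map X = μ) (hElaw : P.map E = ν.withDensity ρ) (hXE : IndepFun X E P)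
    (hpos : ∀ y, ∫⁻ x, ρ (y - G x) ∂μ ≠ 0) :
    ∀ᵐ y ∂ν, condDistrib X (fun ω => G (X ω) + E ω) P y =
      μ.withDensity fun x => ρ (y - G x) / ∫⁻ x', ρ (y - G x') ∂μ := by
  set Y : Ω → H := fun ω => G (X ω) + E ω
  set z : H → ℝ≥0∞ := fun y => ∫⁻ x, ρ (y - G x) ∂μ
  have hY : Measurable Y := by fun_prop
  have hρG : Measurable fun p : H × S => ρ (p.1 - G p.2) := by fun_prop
  have hz : Measurable z := hρG.lintegral_prod_right'
  have hztop : ∀ y, z y ≠ ∞ := fun y => by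
    refine ((lintegral_mono fun x => hρc (y - G x)).trans_lt ?_).ne
    rw [lintegral_const]
    exact ENNReal.mul_lt_top hc.lt_top (measure_lt_top μ _)
  have hdens : Measurable (Function.uncurry fun y x => ρ (y - G x) / z y) :=
    hρG.div (hz.comp measurable_fst)
  set κ : Kernel H S := Kernel.withDensity (Kernel.const H μ) fun y x => ρ (y - G x) / z y
    with hκdef
  have hκ : ∀ y, κ y = μ.withDensity fun x => ρ (y - G x) / z y := fun y => by
    rw [hκdef, Kernel.withDensity_apply _ hdens, Kernel.const_apply]
  have : IsMarkovKernel κ := ⟨fun y => ⟨by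
    rw [hκ, withDensity_apply _ MeasurableSet.univ, setLIntegral_univ]
    simp_rw [div_eq_mul_inv]
    rw [lintegral_mul_const _ (by fun_prop)]
    exact ENNReal.mul_inv_cancel (hpos y) (hztop y)⟩⟩
  have hYlaw : P.map Y = ν.withDensity z := by
    refine Measure.ext_of_lintegral _ fun k hk => ?_
    have hmap : P.map Y = (P.map fun ω => (Y ω, X ω)).map Prod.fst := by
      rw [Measure.map_map measurable_fst (by fun_prop)]
      rfl
    rw [hmap, lintegral_map hk measurable_fst,
      lintegral_map_add_prodMk hρ hG hX hE hXlaw hElaw hXE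
        (h := fun p => k p.1) (by fun_prop),
      lintegral_withDensity_eq_lintegral_mul _ hz hk]
    refine lintegral_congr fun y => ?_
    exact lintegral_mul_const (f := fun x => ρ (y - G x)) (k y) (by fun_prop)
  have hcompProd : P.map (fun ω => (Y ω, X ω)) = P.map Y ⊗ₘ κ := by
    refine Measure.ext_of_lintegral _ fun h hh => ?_
    rw [lintegral_map_add_prodMk hρ hG hX hE hXlaw hElaw hXE hh, Measure.lintegral_compProd hh,
      hYlaw, lintegral_withDensity_eq_lintegral_mul _ hz hh.lintegral_kernel_prod_right']
    refine lintegral_congr fun y => ?_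
    rw [Pi.mul_apply, hκ, lintegral_withDensity_eq_lintegral_mul _ (by fun_prop) (by fun_prop),
      ← lintegral_const_mul _ (by fun_prop)]
    refine lintegral_congr fun x => ?_
    rw [Pi.mul_apply, ← mul_assoc, ENNReal.mul_div_cancel (hpos y) (hztop y)]
  have hac : ν ≪ P.map Y := hYlaw ▸
    withDensity_absolutelyContinuous' hz.aemeasurable (ae_of_all _ hpos)
  filter_upwards [hac.ae_le
    (condDistrib_ae_eq_of_measure_eq_compProd Y hX.aemeasurable hcompProd)] with y hy
  rw [hy, hκ]

end AdditiveNoise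


/-- **Bayes' theorem for the Bayesian inverse problem.**
Let `μ₀` be a Borel probability (prior) measure on `ℝⁿ`, `Γ` a symmetric positive definite
`N × N` matrix, `μ_e = N(0, Γ)` the Gaussian noise measure on `ℝᴺ` (with Lebesgue density
`(2π)^{-N/2} det(Γ)^{-1/2} exp(-½ yᵀ Γ⁻¹ y)`), and `G : ℝⁿ → ℝᴺ` measurable.  Define the
least-squares potential `Φ(x; y) = ½ (y − G x)ᵀ Γ⁻¹ (y − G x)` (i.e. `½‖Γ^{-1/2}(y − G x)‖²`),
assumed measurable w.r.t. the product measure `μ₀ ⊗ μ_e`, and assume the normalization constant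
`Z(y) = ∫ exp(−Φ(x; y)) μ₀(dx)` is strictly positive for `μ_e`-a.e. `y`.
Then for `μ_e`-a.e. `y`, the conditional distribution of `x` given `Y = y` under the joint law
of `(x, Y)` with `Y = G(x) + e`, `x ~ μ₀`, `e ~ μ_e` independent, is absolutely continuous
w.r.t. `μ₀` with Radon–Nikodym density `exp(−Φ(x; y)) / Z(y)`. -/
theorem bayes_posterior_density
    {n N : ℕ} {Ω : Type*} [MeasureSpace Ω] [IsProbabilityMeasure (ℙ : Measure Ω)]
    (μ₀ : Measure (Fin n → ℝ)) [IsProbabilityMeasure μ₀]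
    (Γ : Matrix (Fin N) (Fin N) ℝ) (hΓsymm : Γ.IsSymm) (hΓpos : Γ.PosDef)
    (G : (Fin n → ℝ) → (Fin N → ℝ)) (hG : Measurable G)
    (μe : Measure (Fin N → ℝ))
    (hμe : μe = (volume : Measure (Fin N → ℝ)).withDensity fun y =>
      ENNReal.ofReal ((Real.sqrt ((2 * Real.pi) ^ N * Γ.det))⁻¹ *
        Real.exp (-(1 / 2 : ℝ) * (y ⬝ᵥ (Γ⁻¹ *ᵥ y)))))
    (X : Ω → (Fin n → ℝ)) (E : Ω → (Fin N → ℝ))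
    (hX : Measurable X) (hE : Measurable E)
    (hXlaw : Measure.map X ℙ = μ₀) (hElaw : Measure.map E ℙ = μe)
    (hindep : IndepFun X E ℙ)
    (Y : Ω → (Fin N → ℝ)) (hY : Y = fun ω => G (X ω) + E ω)
    (Φ : (Fin n → ℝ) → (Fin N → ℝ) → ℝ)
    (hΦdef : ∀ x y, Φ x y = (1 / 2 : ℝ) * ((y - G x) ⬝ᵥ (Γ⁻¹ *ᵥ (y - G x))))
    (hΦmeas : AEMeasurable (Function.uncurry Φ) (μ₀.prod μe))
    (Z : (Fin N → ℝ) → ℝ)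
    (hZdef : ∀ y, Z y = ∫ x, Real.exp (-(Φ x y)) ∂μ₀)
    (hZpos : ∀ᵐ y ∂μe, 0 < Z y) :
    ∀ᵐ y ∂μe,
      (condDistrib X Y ℙ) y ≪ μ₀ ∧
      (condDistrib X Y ℙ) y
        = μ₀.withDensity fun x => ENNReal.ofReal (Real.exp (-(Φ x y)) / Z y) := by
  have hnoise_pos : 0 < (Real.sqrt ((2 * Real.pi) ^ N * Γ.det))⁻¹ :=
    inv_pos.2 (Real.sqrt_pos.2 (mul_pos (by positivity) hΓpos.det_pos))
  set c : ℝ := (Real.sqrt ((2 * Real.pi) ^ N * Γ.det))⁻¹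
  set ρ : (Fin N → ℝ) → ℝ≥0∞ := fun y =>
    ENNReal.ofReal (c * Real.exp (-(1 / 2 : ℝ) * (y ⬝ᵥ (Γ⁻¹ *ᵥ y)))) with hρdef
  have hquad : Continuous fun y : Fin N → ℝ => y ⬝ᵥ (Γ⁻¹ *ᵥ y) := by fun_prop
  have hquad_nonneg : ∀ y : Fin N → ℝ, 0 ≤ y ⬝ᵥ (Γ⁻¹ *ᵥ y) := fun y => by
    simpa using hΓpos.inv.posSemidef.dotProduct_mulVec_nonneg y
  have hρ : Measurable ρ := by
    have := hquad.measurable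
    fun_prop
  have hρle : ∀ y, ρ y ≤ ENNReal.ofReal c := fun y => by
    refine ENNReal.ofReal_le_ofReal (mul_le_of_le_one_right hnoise_pos.le ?_)
    rw [Real.exp_le_one_iff]
    linarith [hquad_nonneg y]
  have hρΦ : ∀ x y, ρ (y - G x) = ENNReal.ofReal (c * Real.exp (-(Φ x y))) := fun x y => by
    rw [hρdef, hΦdef, ← neg_mul]
  have hint : ∀ y, Integrable (fun x => Real.exp (-(Φ x y))) μ₀ := fun y => by
    have hmeas : Measurable fun x => Φ x y := by
      simp_rw [hΦdef]
      exact (hquad.measurable.comp (measurable_const.sub hG)).const_mul _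
    refine Integrable.of_bound (C := 1) (by fun_prop) (ae_of_all _ fun x => ?_)
    rw [Real.norm_of_nonneg (Real.exp_pos _).le, Real.exp_le_one_iff, hΦdef]
    linarith [hquad_nonneg (y - G x)]
  have hevidence : ∀ y, ∫⁻ x, ρ (y - G x) ∂μ₀ = ENNReal.ofReal (c * Z y) := fun y => by
    simp_rw [hρΦ]
    rw [hZdef, ← integral_const_mul, ofReal_integral_eq_lintegral_ofReal ((hint y).const_mul c)
      (ae_of_all _ fun x => by positivity)]
  have hZ : ∀ y, 0 < Z y := fun y => by
    rw [hZdef]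
    exact integral_exp_pos (hint y)
  have hμe_ac : μe ≪ volume := hμe ▸ withDensity_absolutelyContinuous _ _
  have hposterior := condDistrib_add_noise_ae_eq hρ ENNReal.ofReal_ne_top hρle hG hX hE hXlaw
    (hElaw.trans hμe) hindep fun y => by
      rw [hevidence]
      exact (ENNReal.ofReal_pos.2 (mul_pos hnoise_pos (hZ y))).ne'
  filter_upwards [hμe_ac.ae_le hposterior] with y hy
  have hdensity : (condDistrib X Y ℙ) y
      = μ₀.withDensity fun x => ENNReal.ofReal (Real.exp (-(Φ x y)) / Z y) := by
    rw [hY, hy]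
    congr 1 with x
    rw [hevidence, hρΦ, ← ENNReal.ofReal_div_of_pos (mul_pos hnoise_pos (hZ y)),
      mul_div_mul_left _ _ hnoise_pos.ne']
  exact ⟨hdensity ▸ withDensity_absolutelyContinuous _ _, hdensity⟩
end

section
/- Let μ₀ be a Borel probability measure on ℝⁿ and let Φ, Φ^L : ℝⁿ → ℝ be continuous potentials (Φ^L an approximation of Φ indexed by L ∈ ℕ). Assume there exist functions M₁, M₂ : ℝ₊ → ℝ₊, independent of L, monotonic non-decreasing, with M₂ strictly positive, such that for all x ∈ ℝⁿ: Φ(x) ≥ −M₁(‖x‖), Φ^L(x) ≥ −M₁(‖x‖), and |Φ(x) − Φ^L(x)| ≤ M₂(‖x‖) ψ(L), where ψ(L) → 0 as L → ∞. Assume μ₀(B) > 0 for some bounded measurable set B ⊆ ℝⁿ, and that x ↦ exp(M₁(‖x‖))(1 + M₂(‖x‖)²) is μ₀-integrable. Define the probability measures μ(dx) = Z⁻¹ exp(−Φ(x)) μ₀(dx) and μ_L(dx) = Z_L⁻¹ exp(−Φ^L(x)) μ₀(dx), where Z and Z_L are the corresponding normalization constants. Then there exists a constant C, independent of L, such that the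 Hellinger distance satisfies d_Hell(μ, μ_L) ≤ C ψ(L). -/
open MeasureTheory Filter NNReal ENNReal

/-- The Hellinger distance between two measures `μ` and `ν`, both absolutely continuous with
respect to a common dominating σ-finite measure `base`:
`d_Hell(μ, ν) = (½ ∫ (√(dμ/dbase) − √(dν/dbase))² dbase)^{1/2}`. -/
noncomputable def hellingerDist {α : Type*} [MeasurableSpace α] (μ ν base : Measure α) : ℝ :=
  Real.sqrt ((1 / 2 : ℝ) *
    ∫ x, (Real.sqrt ((μ.rnDeriv base x).toReal) - Real.sqrt ((ν.rnDeriv base x).toReal)) ^ 2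
      ∂base)

theorem abs_exp_sub_exp_le_exp_mul {a b m : ℝ} (ha : a ≤ m) (hb : b ≤ m) :
    |Real.exp a - Real.exp b| ≤ Real.exp m * |a - b| := by
  have key : ∀ {a b : ℝ}, a ≤ m → b ≤ a →
      |Real.exp a - Real.exp b| ≤ Real.exp m * |a - b| := by
    intro a b ha hab
    rw [abs_of_nonneg (sub_nonneg.2 (Real.exp_le_exp.2 hab)), abs_of_nonneg (sub_nonneg.2 hab)]
    have h₁ : Real.exp b = Real.exp a * Real.exp (b - a) := by
      rw [← Real.exp_add]
      congr 1
      ring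
    have h₂ := mul_le_mul_of_nonneg_left (Real.add_one_le_exp (b - a)) (Real.exp_pos a).le
    have h₃ := mul_le_mul_of_nonneg_right (Real.exp_le_exp.2 ha) (sub_nonneg.2 hab)
    linarith
  rcases le_total b a with h | h
  · exact key ha h
  · rw [abs_sub_comm, abs_sub_comm a]
    exact key hb h

theorem sq_inv_sqrt_sub_inv_sqrt_le {z Z W : ℝ} (hz : 0 < z) (hZ : z ≤ Z) (hW : z ≤ W) :
    ((√Z)⁻¹ - (√W)⁻¹) ^ 2 ≤ (Z - W) ^ 2 / z ^ 3 := by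
  have hs : 0 < √Z := Real.sqrt_pos.2 (hz.trans_le hZ)
  have ht : 0 < √W := Real.sqrt_pos.2 (hz.trans_le hW)
  have hs2 : √Z ^ 2 = Z := Real.sq_sqrt (hz.le.trans hZ)
  have ht2 : √W ^ 2 = W := Real.sq_sqrt (hz.le.trans hW)
  have hdiff : (Z - W) ^ 2 = (√Z - √W) ^ 2 * (√Z + √W) ^ 2 := by
    rw [← mul_pow, ← hs2, ← ht2, Real.sqrt_sq hs.le, Real.sqrt_sq ht.le]
    ring
  have hprod : z ^ 3 ≤ (√Z + √W) ^ 2 * (√Z ^ 2 * √W ^ 2) := by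
    have h₁ : z ≤ (√Z + √W) ^ 2 := by nlinarith [mul_pos hs ht]
    have h₂ : z * z ≤ √Z ^ 2 * √W ^ 2 := by
      rw [hs2, ht2]
      exact mul_le_mul hZ hW hz.le (hz.le.trans hZ)
    calc z ^ 3 = z * (z * z) := by ring
      _ ≤ _ := mul_le_mul h₁ h₂ (by positivity) (by positivity)
  have hleft : ((√Z)⁻¹ - (√W)⁻¹) ^ 2 = (√Z - √W) ^ 2 / (√Z ^ 2 * √W ^ 2) := by
    field_simp
    ring
  rw [hleft, hdiff, div_le_div_iff₀ (by positivity) (by positivity), mul_assoc]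
  exact mul_le_mul_of_nonneg_left hprod (sq_nonneg _)

/-- Pointwise comparison of the square roots of two normalised Gibbs densities. -/
theorem sq_sqrt_exp_div_sub_le {s t m k z Z W : ℝ} (hs : -m ≤ s) (ht : -m ≤ t)
    (hst : |s - t| ≤ k) (hz : 0 < z) (hZ : z ≤ Z) (hW : z ≤ W) :
    (√(Real.exp (-s) / Z) - √(Real.exp (-t) / W)) ^ 2 ≤
      2 * Real.exp m * (k ^ 2 / z + (Z - W) ^ 2 / z ^ 3) := by
  have hroot : ∀ s Z : ℝ, √(Real.exp (-s) / Z) = Real.exp (-s / 2) * (√Z)⁻¹ := by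
    intro s Z
    rw [Real.sqrt_div (Real.exp_pos _).le, Real.exp_half, div_eq_mul_inv]
  have hm : Real.exp (m / 2) ^ 2 = Real.exp m := by
    rw [← Real.exp_nat_mul]
    congr 1
    push_cast
    ring
  have hpq : (Real.exp (-s / 2) - Real.exp (-t / 2)) ^ 2 ≤ Real.exp m * k ^ 2 := by
    have h := abs_exp_sub_exp_le_exp_mul (a := -s / 2) (b := -t / 2) (m := m / 2)
      (by linarith) (by linarith)
    have h' : |-s / 2 - -t / 2| ≤ k := by
      have : -s / 2 - -t / 2 = -((s - t) / 2) := by ring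
      rw [this, abs_neg, abs_div, abs_two]
      linarith [abs_nonneg (s - t)]
    rw [← hm, ← mul_pow, ← sq_abs]
    exact pow_le_pow_left₀ (abs_nonneg _)
      (h.trans (mul_le_mul_of_nonneg_left h' (Real.exp_pos _).le)) 2
  have hq : Real.exp (-t / 2) ^ 2 ≤ Real.exp m := by
    rw [← hm]
    exact pow_le_pow_left₀ (Real.exp_pos _).le (Real.exp_le_exp.2 (by linarith)) 2
  have hinv : ((√Z)⁻¹) ^ 2 ≤ z⁻¹ := by
    rw [inv_pow, Real.sq_sqrt (hz.le.trans hZ)]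
    exact inv_anti₀ hz hZ
  have h₁ := mul_le_mul hpq hinv (sq_nonneg _) (by positivity)
  have h₂ := mul_le_mul hq (sq_inv_sqrt_sub_inv_sqrt_le hz hZ hW) (sq_nonneg _) (by positivity)
  rw [hroot, hroot]
  have h₃ := add_sq_le (a := (Real.exp (-s / 2) - Real.exp (-t / 2)) * (√Z)⁻¹)
    (b := Real.exp (-t / 2) * ((√Z)⁻¹ - (√W)⁻¹))
  rw [mul_pow, mul_pow] at h₃
  calc _ = ((Real.exp (-s / 2) - Real.exp (-t / 2)) * (√Z)⁻¹
        + Real.exp (-t / 2) * ((√Z)⁻¹ - (√W)⁻¹)) ^ 2 := by ring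
    _ ≤ _ := h₃
    _ ≤ 2 * (Real.exp m * k ^ 2 * z⁻¹ + Real.exp m * ((Z - W) ^ 2 / z ^ 3)) := by gcongr
    _ = _ := by ring

/-- Stability of the posterior w.r.t. approximation of the potential, in
Hellinger distance.  Under lower bounds `Φ(x), Φ^L(x) ≥ −M₁(‖x‖)`, the approximation bound
`|Φ(x) − Φ^L(x)| ≤ M₂(‖x‖) ψ(L)` with `ψ(L) → 0`, positivity of the prior mass of some bounded
set, and integrability of `exp(M₁(‖x‖))(1 + M₂(‖x‖)²)` w.r.t. the prior `μ₀`, the posteriors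
`μ ∝ exp(−Φ) μ₀` and `μ_L ∝ exp(−Φ^L) μ₀` satisfy `d_Hell(μ, μ_L) ≤ C ψ(L)` for a constant `C`
independent of `L`. -/
theorem hellinger_stability_of_surrogate_posterior
    {n : ℕ}
    (μ₀ : Measure (EuclideanSpace ℝ (Fin n))) [IsProbabilityMeasure μ₀]
    (Φ : EuclideanSpace ℝ (Fin n) → ℝ) (ΦL : ℕ → EuclideanSpace ℝ (Fin n) → ℝ)
    (hΦcont : Continuous Φ) (hΦLcont : ∀ L, Continuous (ΦL L))
    (M₁ M₂ : ℝ≥0 → ℝ≥0) (hM₁mono : Monotone M₁) (hM₂mono : Monotone M₂)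
    (hM₂pos : ∀ r, 0 < M₂ r)
    (ψ : ℕ → ℝ) (hψ : Tendsto ψ atTop (nhds 0))
    (hΦlb : ∀ x, -(M₁ ‖x‖₊ : ℝ) ≤ Φ x)
    (hΦLlb : ∀ L x, -(M₁ ‖x‖₊ : ℝ) ≤ ΦL L x)
    (hclose : ∀ L x, |Φ x - ΦL L x| ≤ (M₂ ‖x‖₊ : ℝ) * ψ L)
    (B : Set (EuclideanSpace ℝ (Fin n))) (hBbdd : Bornology.IsBounded B)
    (hBmeas : MeasurableSet B) (hBpos : 0 < μ₀ B)
    (hint : Integrable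
      (fun x => Real.exp (M₁ ‖x‖₊) * (1 + (M₂ ‖x‖₊ : ℝ) ^ 2)) μ₀)
    (Z : ℝ) (hZ : Z = ∫ x, Real.exp (-Φ x) ∂μ₀)
    (ZL : ℕ → ℝ) (hZL : ∀ L, ZL L = ∫ x, Real.exp (-(ΦL L x)) ∂μ₀)
    (μpost : Measure (EuclideanSpace ℝ (Fin n)))
    (hμpost : μpost = μ₀.withDensity fun x => ENNReal.ofReal (Real.exp (-Φ x) / Z))
    (μLpost : ℕ → Measure (EuclideanSpace ℝ (Fin n)))
    (hμLpost : ∀ L,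
      μLpost L = μ₀.withDensity fun x => ENNReal.ofReal (Real.exp (-(ΦL L x)) / ZL L)) :
    ∃ C : ℝ, ∀ L, hellingerDist μpost (μLpost L) μ₀ ≤ C * ψ L := by
  have hψ0 : ∀ L, 0 ≤ ψ L := fun L =>
    nonneg_of_mul_nonneg_right ((abs_nonneg _).trans (hclose L 0)) (NNReal.coe_pos.2 (hM₂pos _))
  obtain ⟨K, hK⟩ : ∃ K, ∀ L, ψ L ≤ K := by
    obtain ⟨K, hK⟩ := hψ.bddAbove_range
    exact ⟨K, fun L => hK ⟨L, rfl⟩⟩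
  have hK0 : 0 ≤ K := (hψ0 0).trans (hK 0)
  set G : EuclideanSpace ℝ (Fin n) → ℝ :=
    fun x => Real.exp (M₁ ‖x‖₊) * (1 + (M₂ ‖x‖₊ : ℝ) ^ 2) with hG
  have hmeas₂ : Measurable fun x : EuclideanSpace ℝ (Fin n) => (M₂ ‖x‖₊ : ℝ) :=
    (hM₂mono.measurable.comp measurable_nnnorm).coe_nnreal_real
  have hexpG : ∀ x, Real.exp (M₁ ‖x‖₊) ≤ G x := fun x =>
    le_mul_of_one_le_right (Real.exp_pos _).le (by nlinarith [sq_nonneg (M₂ ‖x‖₊ : ℝ)])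
  have hintexp : ∀ F : EuclideanSpace ℝ (Fin n) → ℝ, Measurable F →
      (∀ x, -(M₁ ‖x‖₊ : ℝ) ≤ F x) → Integrable (fun x => Real.exp (-F x)) μ₀ := by
    intro F hF hlb
    refine hint.mono' hF.neg.exp.aestronglyMeasurable (ae_of_all _ fun x => ?_)
    rw [Real.norm_eq_abs, Real.abs_exp]
    exact (Real.exp_le_exp.2 (by linarith [hlb x])).trans (hexpG x)
  have hiΦ := hintexp Φ hΦcont.measurable hΦlb
  have hiΦL := fun L => hintexp (ΦL L) (hΦLcont L).measurable (hΦLlb L)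
  have hiz : Integrable (fun x => Real.exp (-(Φ x + M₂ ‖x‖₊ * K))) μ₀ :=
    hintexp _ (hΦcont.measurable.add (hmeas₂.mul_const K)) fun x =>
      (hΦlb x).trans (le_add_of_nonneg_right (by positivity))
  obtain ⟨z, hz⟩ : ∃ z, z = ∫ x, Real.exp (-(Φ x + M₂ ‖x‖₊ * K)) ∂μ₀ := ⟨_, rfl⟩
  have hzpos : 0 < z := hz ▸ integral_exp_pos hiz
  have hzZ : z ≤ Z := by
    rw [hz, hZ]
    refine integral_mono hiz hiΦ fun x => Real.exp_le_exp.2 ?_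
    have : 0 ≤ (M₂ ‖x‖₊ : ℝ) * K := by positivity
    linarith
  have hzZL : ∀ L, z ≤ ZL L := by
    intro L
    rw [hz, hZL]
    refine integral_mono hiz (hiΦL L) fun x => Real.exp_le_exp.2 ?_
    have h₁ := (abs_le.1 (hclose L x)).1
    have h₂ := mul_le_mul_of_nonneg_left (hK L) (M₂ ‖x‖₊).coe_nonneg
    linarith
  obtain ⟨I, hI⟩ : ∃ I, I = ∫ x, G x ∂μ₀ := ⟨_, rfl⟩
  have hI0 : 0 ≤ I := hI ▸ integral_nonneg fun x => by positivity
  have hZdiff : ∀ L, (Z - ZL L) ^ 2 ≤ (I * ψ L) ^ 2 := by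
    intro L
    rw [← sq_abs]
    refine pow_le_pow_left₀ (abs_nonneg _) ?_ 2
    rw [hZ, hZL, ← integral_sub hiΦ (hiΦL L), hI, ← integral_mul_const, ← Real.norm_eq_abs]
    refine norm_integral_le_of_norm_le (hint.mul_const _) (ae_of_all _ fun x => ?_)
    rw [Real.norm_eq_abs]
    have h := abs_exp_sub_exp_le_exp_mul (a := -Φ x) (b := -ΦL L x) (m := M₁ ‖x‖₊)
      (by linarith [hΦlb x]) (by linarith [hΦLlb L x])
    have h' : |-Φ x - -ΦL L x| = |Φ x - ΦL L x| := by
      rw [← abs_neg]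
      congr 1
      ring
    rw [h'] at h
    refine h.trans ?_
    rw [hG]
    simp only [mul_assoc]
    refine mul_le_mul_of_nonneg_left ((hclose L x).trans ?_) (Real.exp_pos _).le
    exact mul_le_mul_of_nonneg_right (by nlinarith [sq_nonneg ((M₂ ‖x‖₊ : ℝ) - 1)]) (hψ0 L)
  set D : ℝ := 2 * (1 / z + I ^ 2 / z ^ 3) with hD
  have hdens : ∀ (F : EuclideanSpace ℝ (Fin n) → ℝ) (W : ℝ), Measurable F → 0 < W →
      ∀ᵐ x ∂μ₀, ((μ₀.withDensity fun x => ENNReal.ofReal (Real.exp (-F x) / W)).rnDeriv μ₀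
        x).toReal = Real.exp (-F x) / W := by
    intro F W hF hW
    filter_upwards [Measure.rnDeriv_withDensity μ₀
      (hF.neg.exp.div_const W).ennreal_ofReal] with x hx
    simp only [Pi.neg_apply] at hx
    rw [hx, ENNReal.toReal_ofReal (by positivity)]
  refine ⟨√(1 / 2 * (I * D)), fun L => ?_⟩
  have hint_le : ∫ x, (√((μpost.rnDeriv μ₀ x).toReal) - √(((μLpost L).rnDeriv μ₀ x).toReal)) ^ 2
      ∂μ₀ ≤ I * (D * ψ L ^ 2) := by
    rw [hI, ← integral_mul_const]
    refine integral_mono_of_nonneg (ae_of_all _ fun x => sq_nonneg _) (hint.mul_const _) ?_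
    rw [hμpost, hμLpost]
    filter_upwards [hdens Φ Z hΦcont.measurable (hzpos.trans_le hzZ),
      hdens (ΦL L) (ZL L) (hΦLcont L).measurable (hzpos.trans_le (hzZL L))] with x h₁ h₂
    rw [h₁, h₂]
    refine (sq_sqrt_exp_div_sub_le (hΦlb x) (hΦLlb L x) (hclose L x) hzpos hzZ (hzZL L)).trans ?_
    have hM : (M₂ ‖x‖₊ : ℝ) ^ 2 ≤ 1 + (M₂ ‖x‖₊ : ℝ) ^ 2 := by linarith
    have hone : 1 ≤ 1 + (M₂ ‖x‖₊ : ℝ) ^ 2 := by linarith [sq_nonneg (M₂ ‖x‖₊ : ℝ)]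
    calc 2 * Real.exp (M₁ ‖x‖₊) * ((M₂ ‖x‖₊ * ψ L) ^ 2 / z + (Z - ZL L) ^ 2 / z ^ 3)
        ≤ 2 * Real.exp (M₁ ‖x‖₊) * ((1 + (M₂ ‖x‖₊ : ℝ) ^ 2) * ψ L ^ 2 / z
          + (1 + (M₂ ‖x‖₊ : ℝ) ^ 2) * (I * ψ L) ^ 2 / z ^ 3) := by
          rw [mul_pow]
          gcongr
          exact (hZdiff L).trans (le_mul_of_one_le_left (sq_nonneg _) hone)
      _ = G x * (D * ψ L ^ 2) := by
          rw [hG, hD]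
          ring
  calc hellingerDist μpost (μLpost L) μ₀ ≤ √(1 / 2 * (I * D) * ψ L ^ 2) := by
        refine Real.sqrt_le_sqrt ?_
        linarith
    _ = √(1 / 2 * (I * D)) * ψ L := by
        rw [Real.sqrt_mul (by positivity), Real.sqrt_sq (hψ0 L)]
end

section
/- Let (X, S) be a pair of random variables with values in ℝⁿ × ℝᵈ on a probability space, and let φ : ℝⁿ → ℝ be measurable with φ(X) integrable. Denote by ν the law of S on ℝᵈ. Then for ν-almost every s† ∈ ℝᵈ, the conditional expectation of φ(X) given that S lies in the closed ball of radius δ around s† converges to the conditional expectation given S = s† as δ → 0: E[φ(X) · 1_{‖S − s†‖ ≤ δ}] / P(‖S − s†‖ ≤ δ) → E[φ(X) | S = s†](s†) as δ → 0 (where the ratio is defined for all δ with P(‖S − s†‖ ≤ δ) > 0, which holds for ν-a.e. s†). -/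
open MeasureTheory ProbabilityTheory Filter

/-- **small-threshold consistency of ABC conditioning.**
Let `(X, S)` be random variables with values in `ℝⁿ × ℝᵈ`, `φ : ℝⁿ → ℝ` measurable with
`φ(X)` integrable, and let `ν = law(S)`.  Let `g` be a measurable function of the value of `S`
such that `g ∘ S` is a version of the conditional expectation `E[φ(X) | σ(S)]`.
Then for `ν`-almost every `s†`, the ball-conditioned expectations are well defined
(`P(‖S − s†‖ ≤ δ) > 0` for all `δ > 0`) and
`E[φ(X) · 1_{‖S − s†‖ ≤ δ}] / P(‖S − s†‖ ≤ δ) → E[φ(X) | S = s†] = g(s†)` as `δ → 0⁺`. -/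
theorem abc_ball_conditioning_converges
    {n d : ℕ} {Ω : Type*} [MeasureSpace Ω] [IsProbabilityMeasure (ℙ : Measure Ω)]
    (X : Ω → EuclideanSpace ℝ (Fin n)) (S : Ω → EuclideanSpace ℝ (Fin d))
    (hX : Measurable X) (hS : Measurable S)
    (φ : EuclideanSpace ℝ (Fin n) → ℝ) (hφ : Measurable φ)
    (hint : Integrable (fun ω => φ (X ω)) ℙ)
    (g : EuclideanSpace ℝ (Fin d) → ℝ) (hgmeas : Measurable g)
    (hg : (fun ω => g (S ω)) =ᵐ[ℙ]
      ℙ[(fun ω => φ (X ω)) | MeasurableSpace.comap S inferInstance]) :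
    ∀ᵐ s ∂(Measure.map S ℙ),
      (∀ δ : ℝ, 0 < δ → 0 < ℙ {ω | ‖S ω - s‖ ≤ δ}) ∧
      Tendsto
        (fun δ : ℝ =>
          (∫ ω in {ω | ‖S ω - s‖ ≤ δ}, φ (X ω) ∂ℙ) / (ℙ {ω | ‖S ω - s‖ ≤ δ}).toReal)
        (nhdsWithin 0 (Set.Ioi 0)) (nhds (g s)) := by
  set ν : Measure (EuclideanSpace ℝ (Fin d)) := Measure.map S ℙ with hν
  have : IsProbabilityMeasure ν := Measure.isProbabilityMeasure_map hS.aemeasurable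
  have hball : ∀ (s : EuclideanSpace ℝ (Fin d)) (δ : ℝ),
      {ω | ‖S ω - s‖ ≤ δ} = S ⁻¹' Metric.closedBall s δ := by
    intro s δ
    ext ω
    simp [dist_eq_norm]
  have hmass : ∀ (s : EuclideanSpace ℝ (Fin d)) (δ : ℝ),
      ℙ {ω | ‖S ω - s‖ ≤ δ} = ν (Metric.closedBall s δ) := by
    intro s δ
    rw [hball, hν, Measure.map_apply hS Metric.isClosed_closedBall.measurableSet]
  have hgS : Integrable (fun ω => g (S ω)) ℙ := integrable_condExp.congr hg.symm
  have hgν : Integrable g ν :=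
    (integrable_map_measure hgmeas.aestronglyMeasurable hS.aemeasurable).2 hgS
  have hnum : ∀ (s : EuclideanSpace ℝ (Fin d)) (δ : ℝ),
      ∫ ω in {ω | ‖S ω - s‖ ≤ δ}, φ (X ω) ∂ℙ = ∫ y in Metric.closedBall s δ, g y ∂ν := by
    intro s δ
    have hB : MeasurableSet (Metric.closedBall s δ) := Metric.isClosed_closedBall.measurableSet
    rw [hball, ← setIntegral_condExp hS.comap_le hint ⟨_, hB, rfl⟩, hν,
      setIntegral_map hB hgmeas.aestronglyMeasurable hS.aemeasurable]
    exact integral_congr_ae (ae_restrict_of_ae hg.symm)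
  filter_upwards [(Besicovitch.vitaliFamily ν).ae_eventually_measure_pos,
    (Besicovitch.vitaliFamily ν).ae_tendsto_average hgν.locallyIntegrable] with s hpos hlim
  have hfilter := Besicovitch.tendsto_filterAt ν s
  refine ⟨fun δ hδ => ?_, ?_⟩
  · obtain ⟨r, hr, hrδ⟩ :=
      ((hfilter.eventually hpos).and (Ioc_mem_nhdsGT hδ)).exists
    rw [hmass]
    exact hr.trans_le (measure_mono (Metric.closedBall_subset_closedBall hrδ.2))
  · refine (hlim.comp hfilter).congr fun δ => ?_
    rw [Function.comp_apply, setAverage_eq, hnum, hmass, smul_eq_mul, Measure.real,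
      div_eq_inv_mul]
end
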